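/- arXiv:math/0602495 — 10 statements merged into one kernel-verified Lean document; each statement's English description precedes it below -/
import Mathlib

section
/- Let 𝓝 = {y ∈ ℝⁿ : Ky = 0} and 𝓡 = {Ry : y ∈ 𝓝} ⊆ ℝᵐ, and let 𝓜 = {a ∈ ℝᵐ : a'R = b'K for some b ∈ ℝᵖ}. Then the orthogonal complement of 𝓡 in ℝᵐ, with respect to the Euclidean inner product, equals 𝓜. (Lemma 4.1) -/
open Matrix

/-- Lemma 4.1: the orthogonal complement (w.r.t. the Euclidean inner product) of
`𝓡 = {Ry : Ky = 0}` in `ℝᵐ` equals `𝓜 = {a : a'R = b'K for some b}`. -/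
theorem stmt_0 (m n p : ℕ) (hm : 0 < m) (hn : 0 < n) (hp : 0 < p)
    (R : Matrix (Fin m) (Fin n) ℝ) (K : Matrix (Fin p) (Fin n) ℝ) :
    {a : Fin m → ℝ |
        ∀ x ∈ {x : Fin m → ℝ | ∃ y ∈ {y : Fin n → ℝ | K *ᵥ y = 0}, R *ᵥ y = x},
          a ⬝ᵥ x = 0}
      = {a : Fin m → ℝ | ∃ b : Fin p → ℝ, a ᵥ* R = b ᵥ* K} := by
  ext a
  simp only [Set.mem_setOf_eq]
  constructor
  · intro h
    have h1 : dotProductEquiv ℝ (Fin n) (a ᵥ* R) ∈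
        LinearMap.range (Matrix.mulVecLin K).dualMap := by
      rw [LinearMap.range_dualMap_eq_dualAnnihilator_ker, Submodule.mem_dualAnnihilator]
      intro y hy
      have h2 : (a ᵥ* R) ⬝ᵥ y = 0 := by
        rw [← Matrix.dotProduct_mulVec]
        exact h _ ⟨y, by simpa using hy, rfl⟩
      simpa using h2
    obtain ⟨φ, hφ⟩ := h1
    obtain ⟨b, rfl⟩ := (dotProductEquiv ℝ (Fin p)).surjective φ
    refine ⟨b, ?_⟩
    apply (dotProductEquiv ℝ (Fin n)).injective
    rw [← hφ]
    refine LinearMap.ext fun y => ?_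
    change b ⬝ᵥ (K *ᵥ y) = (b ᵥ* K) ⬝ᵥ y
    exact Matrix.dotProduct_mulVec b K y
  · rintro ⟨b, hb⟩ x ⟨y, hy, rfl⟩
    rw [Matrix.dotProduct_mulVec, hb, ← Matrix.dotProduct_mulVec, hy, dotProduct_zero]
end

section
/- Under Assumption 2.2, there exist an m-dimensional vector π and a p-dimensional vector κ such that v' = π'R + κ'K, i.e., v = R'π + K'κ where ' denotes transpose. (Lemma 4.3) -/
open Matrix

/-- Lemma 4.3: under the no-arbitrage Assumption 2.2, there exist `π ∈ ℝᵐ` and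
`κ ∈ ℝᵖ` such that `v' = π'R + κ'K`. -/
theorem stmt_3 (m n p : ℕ) (hm : 0 < m) (hn : 0 < n) (hp : 0 < p)
    (R : Matrix (Fin m) (Fin n) ℝ) (K : Matrix (Fin p) (Fin n) ℝ) (v : Fin n → ℝ)
    -- Assumption 2.2 (no-arbitrage)
    (hA : ∀ y : Fin n → ℝ, (∀ i, 0 ≤ (K *ᵥ y) i) → R *ᵥ y = 0 → v ⬝ᵥ y ≤ 0 → y = 0) :
    ∃ (π : Fin m → ℝ) (κ : Fin p → ℝ), v = π ᵥ* R + κ ᵥ* K := by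
  have hinj : LinearMap.ker (Matrix.toLin' (Matrix.fromRows R K)) = ⊥ := by
    rw [LinearMap.ker_eq_bot']
    intro y hy
    rw [Matrix.toLin'_apply, Matrix.fromRows_mulVec] at hy
    have hR : R *ᵥ y = 0 := by
      funext i
      exact congrFun hy (Sum.inl i)
    have hK : K *ᵥ y = 0 := by
      funext i
      exact congrFun hy (Sum.inr i)
    rcases le_total (v ⬝ᵥ y) 0 with h | h
    · exact hA y (fun i => by simp [hK]) hR h
    · have := hA (-y) (fun i => by simp [Matrix.mulVec_neg, hK])
        (by simp [Matrix.mulVec_neg, hR]) (by simpa using h)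
      simpa using this
  obtain ⟨g, hg⟩ := LinearMap.exists_leftInverse_of_injective _ hinj
  have hB : LinearMap.toMatrix' g * Matrix.fromRows R K = 1 := by
    have := congrArg LinearMap.toMatrix' hg
    rwa [LinearMap.toMatrix'_comp, LinearMap.toMatrix'_toLin', LinearMap.toMatrix'_id] at this
  refine ⟨(v ᵥ* LinearMap.toMatrix' g) ∘ Sum.inl, (v ᵥ* LinearMap.toMatrix' g) ∘ Sum.inr, ?_⟩
  rw [← Matrix.vecMul_fromRows, Matrix.vecMul_vecMul, hB, Matrix.vecMul_one]
end

section
/- Suppose x ∈ ℝᵐ and u ∈ 𝓚 = {Ky : y ∈ ℝⁿ} satisfy Mx = Gu. Then there is a unique y ∈ ℝⁿ such that u = Ky and x = Ry, and this y satisfies v'y = π'x + κ'u. (Lemma 4.4) -/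
open Matrix

/-- Lemma 4.4: if `x ∈ ℝᵐ` and `u ∈ 𝒦 = {Ky : y ∈ ℝⁿ}` satisfy `Mx = Gu`, then
there is a unique `y` with `Ky = u` and `Ry = x`, and this `y` satisfies
`v'y = π'x + κ'u`. -/
theorem stmt_4 (m n p d : ℕ) (hm : 0 < m) (hn : 0 < n) (hp : 0 < p)
    (R : Matrix (Fin m) (Fin n) ℝ) (K : Matrix (Fin p) (Fin n) ℝ) (v : Fin n → ℝ)
    -- Assumption 2.2 (no-arbitrage)
    (hA : ∀ y : Fin n → ℝ, (∀ i, 0 ≤ (K *ᵥ y) i) → R *ᵥ y = 0 → v ⬝ᵥ y ≤ 0 → y = 0)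
    (M : Matrix (Fin d) (Fin m) ℝ)
    -- rows of `M` form a maximal linearly independent subset of `𝓜 = 𝓡^⊥`
    (hrows : ∀ i : Fin d, ∀ y : Fin n → ℝ, K *ᵥ y = 0 → M i ⬝ᵥ (R *ᵥ y) = 0)
    (hindep : LinearIndependent ℝ fun i : Fin d => M i)
    (hmax : ∀ a : Fin m → ℝ, (∀ y : Fin n → ℝ, K *ᵥ y = 0 → a ⬝ᵥ (R *ᵥ y) = 0) →
      a ∈ Submodule.span ℝ (Set.range fun i : Fin d => M i))
    (G : Matrix (Fin d) (Fin p) ℝ) (hG : M * R = G * K)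
    (π : Fin m → ℝ) (κ : Fin p → ℝ) (hπκ : v = π ᵥ* R + κ ᵥ* K)
    (x : Fin m → ℝ) (u : Fin p → ℝ) (hu : ∃ y : Fin n → ℝ, K *ᵥ y = u)
    (hxu : M *ᵥ x = G *ᵥ u) :
    (∃! y : Fin n → ℝ, K *ᵥ y = u ∧ R *ᵥ y = x) ∧
      ∀ y : Fin n → ℝ, K *ᵥ y = u ∧ R *ᵥ y = x → v ⬝ᵥ y = π ⬝ᵥ x + κ ⬝ᵥ u := by
  have hv : ∀ y : Fin n → ℝ, K *ᵥ y = u ∧ R *ᵥ y = x → v ⬝ᵥ y = π ⬝ᵥ x + κ ⬝ᵥ u := by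
    rintro y ⟨h1, h2⟩
    rw [hπκ, add_dotProduct, ← dotProduct_mulVec, ← dotProduct_mulVec, h1, h2]
  refine ⟨?_, hv⟩
  obtain ⟨y₀, hy₀⟩ := hu
  have hz : M *ᵥ (x - R *ᵥ y₀) = 0 := by
    rw [mulVec_sub, mulVec_mulVec, hG, ← mulVec_mulVec, hy₀, hxu, sub_self]
  have hmem : x - R *ᵥ y₀ ∈ Submodule.map R.mulVecLin (LinearMap.ker K.mulVecLin) := by
    by_contra hne
    obtain ⟨f, hf, hW⟩ := Submodule.exists_le_ker_of_notMem hne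
    have hfa : ∀ w, f w = (fun i => f (Pi.single i 1)) ⬝ᵥ w := by
      intro w
      rw [LinearMap.pi_apply_eq_sum_univ f w]
      simp only [dotProduct, smul_eq_mul]
      refine Finset.sum_congr rfl fun i _ => ?_
      rw [mul_comm]
      congr 2
      ext j
      simp [Pi.single_apply, eq_comm]
    have hspan := hmax (fun i => f (Pi.single i 1)) (by
      intro y hy
      rw [← hfa]
      exact hW ⟨y, by simpa using hy, by simp⟩)
    apply hf
    rw [hfa]
    refine Submodule.span_induction (p := fun a _ => a ⬝ᵥ (x - R *ᵥ y₀) = 0) ?_ ?_ ?_ ?_ hspan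
    · rintro _ ⟨i, rfl⟩
      exact congrFun hz i
    · simp
    · intro a b _ _ ha hb
      rw [add_dotProduct, ha, hb, add_zero]
    · intro c a _ ha
      rw [smul_dotProduct, ha, smul_zero]
  obtain ⟨w, hw, hwx⟩ := hmem
  have hw' : K *ᵥ w = 0 := by simpa using hw
  have hwx' : R *ᵥ w = x - R *ᵥ y₀ := by simpa using hwx
  have hy : K *ᵥ (y₀ + w) = u ∧ R *ᵥ (y₀ + w) = x := by
    rw [mulVec_add, mulVec_add, hw', hwx', hy₀]
    simp
  refine ⟨y₀ + w, hy, fun y h => ?_⟩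
  refine sub_eq_zero.mp (hA _ ?_ ?_ ?_)
  · intro i
    rw [mulVec_sub, h.1, hy.1]
    simp
  · rw [mulVec_sub, h.2, hy.2, sub_self]
  · rw [dotProduct_sub, hv _ h, hv _ hy, sub_self]
end

section
/- Assume Assumption 2.2 and let 𝒟 be a nonempty compact subset of ℝᵐ. Then the set {y ∈ ℝⁿ : Ky ≥ 0, Ry ∈ 𝒟, v'y ≤ 0} is either empty or a nonempty compact set, and in either case inf{v'y : y ∈ ℝⁿ, Ky ≥ 0, Ry ∈ 𝒟} > −∞, i.e., the set of values {v'y : Ky ≥ 0, Ry ∈ 𝒟} is bounded below. (Lemma A.3) -/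
open Matrix

/-- Lemma A.3: under the no-arbitrage Assumption 2.2, for any nonempty compact
`𝒟 ⊆ ℝᵐ`, the set `{y : Ky ≥ 0, Ry ∈ 𝒟, v'y ≤ 0}` is empty or nonempty compact,
and in either case `{v'y : Ky ≥ 0, Ry ∈ 𝒟}` is bounded below. -/
theorem stmt_5 (m n p : ℕ) (hm : 0 < m) (hn : 0 < n) (hp : 0 < p)
    (R : Matrix (Fin m) (Fin n) ℝ) (K : Matrix (Fin p) (Fin n) ℝ) (v : Fin n → ℝ)
    -- Assumption 2.2 (no-arbitrage)
    (hA : ∀ y : Fin n → ℝ, (∀ i, 0 ≤ (K *ᵥ y) i) → R *ᵥ y = 0 → v ⬝ᵥ y ≤ 0 → y = 0)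
    (D : Set (Fin m → ℝ)) (hDne : D.Nonempty) (hDc : IsCompact D) :
    (({y : Fin n → ℝ | (∀ i, 0 ≤ (K *ᵥ y) i) ∧ R *ᵥ y ∈ D ∧ v ⬝ᵥ y ≤ 0} = ∅) ∨
      (({y : Fin n → ℝ | (∀ i, 0 ≤ (K *ᵥ y) i) ∧ R *ᵥ y ∈ D ∧ v ⬝ᵥ y ≤ 0}).Nonempty ∧
        IsCompact {y : Fin n → ℝ | (∀ i, 0 ≤ (K *ᵥ y) i) ∧ R *ᵥ y ∈ D ∧ v ⬝ᵥ y ≤ 0})) ∧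
    BddBelow {c : ℝ | ∃ y : Fin n → ℝ, (∀ i, 0 ≤ (K *ᵥ y) i) ∧ R *ᵥ y ∈ D ∧ v ⬝ᵥ y = c} := by
  have hKc : IsClosed {y : Fin n → ℝ | ∀ i, 0 ≤ (K *ᵥ y) i} := by
    simp only [Set.setOf_forall]
    refine isClosed_iInter fun i => isClosed_le continuous_const ?_
    exact (continuous_apply i).comp (Continuous.matrix_mulVec continuous_const continuous_id)
  have hRc : Continuous fun y : Fin n → ℝ => R *ᵥ y :=
    Continuous.matrix_mulVec continuous_const continuous_id
  have hvc : Continuous fun y : Fin n → ℝ => v ⬝ᵥ y :=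
    Continuous.dotProduct continuous_const continuous_id
  have hvcl : IsClosed {y : Fin n → ℝ | v ⬝ᵥ y ≤ 0} := isClosed_le hvc continuous_const
  obtain ⟨B, hB⟩ := hDc.isBounded.exists_norm_le
  have hδ : ∃ δ : ℝ, 0 < δ ∧ ∀ y : Fin n → ℝ, ‖y‖ = 1 → (∀ i, 0 ≤ (K *ᵥ y) i) →
      v ⬝ᵥ y ≤ 0 → δ ≤ ‖R *ᵥ y‖ := by
    have hT : IsCompact (Metric.sphere (0 : Fin n → ℝ) 1 ∩
        ({y : Fin n → ℝ | ∀ i, 0 ≤ (K *ᵥ y) i} ∩ {y : Fin n → ℝ | v ⬝ᵥ y ≤ 0})) :=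
      (isCompact_sphere 0 1).inter_right (hKc.inter hvcl)
    rcases Set.eq_empty_or_nonempty (Metric.sphere (0 : Fin n → ℝ) 1 ∩
        ({y : Fin n → ℝ | ∀ i, 0 ≤ (K *ᵥ y) i} ∩ {y : Fin n → ℝ | v ⬝ᵥ y ≤ 0})) with h | h
    · refine ⟨1, one_pos, fun y h1 h2 h3 => ?_⟩
      have : y ∈ (∅ : Set (Fin n → ℝ)) := by
        rw [← h]
        exact ⟨by simpa using h1, h2, h3⟩
      exact this.elim
    · obtain ⟨z, ⟨hz1, hz2, hz3⟩, hz⟩ := hT.exists_isMinOn h hRc.norm.continuousOn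
      refine ⟨‖R *ᵥ z‖, ?_, fun y h1 h2 h3 => hz ⟨by simpa using h1, h2, h3⟩⟩
      rw [norm_pos_iff]
      intro h0
      have := hA z hz2 h0 hz3
      simp [this] at hz1
  obtain ⟨δ, hδ0, hδ⟩ := hδ
  have hS : IsCompact {y : Fin n → ℝ | (∀ i, 0 ≤ (K *ᵥ y) i) ∧ R *ᵥ y ∈ D ∧ v ⬝ᵥ y ≤ 0} := by
    refine Metric.isCompact_of_isClosed_isBounded
      (hKc.inter ((hDc.isClosed.preimage hRc).inter hvcl)) ?_
    rw [isBounded_iff_forall_norm_le]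
    refine ⟨B / δ, ?_⟩
    rintro y ⟨h1, h2, h3⟩
    have hb := hB _ h2
    rw [le_div_iff₀ hδ0]
    by_cases hy : y = 0
    · subst hy
      simpa using (norm_nonneg _).trans hb
    have hy0 : 0 < ‖y‖ := norm_pos_iff.mpr hy
    have hi : 0 ≤ ‖y‖⁻¹ := inv_nonneg.mpr hy0.le
    have := hδ (‖y‖⁻¹ • y) (by rw [norm_smul, norm_inv, norm_norm, inv_mul_cancel₀ hy0.ne'])
      (fun i => by
        rw [mulVec_smul]
        exact mul_nonneg hi (h1 i))
      (by
        rw [dotProduct_smul]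
        exact mul_nonpos_of_nonneg_of_nonpos hi h3)
    rw [mulVec_smul, norm_smul, norm_inv, norm_norm, inv_mul_eq_div, le_div_iff₀ hy0] at this
    linarith
  constructor
  · rcases Set.eq_empty_or_nonempty
      {y : Fin n → ℝ | (∀ i, 0 ≤ (K *ᵥ y) i) ∧ R *ᵥ y ∈ D ∧ v ⬝ᵥ y ≤ 0} with h | h
    · exact Or.inl h
    · exact Or.inr ⟨h, hS⟩
  · obtain ⟨b, hb⟩ := (hS.image hvc).bddBelow
    refine ⟨min b 0, ?_⟩
    rintro c ⟨y, h1, h2, rfl⟩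
    rcases le_total (v ⬝ᵥ y) 0 with h | h
    · exact (min_le_left _ _).trans (hb ⟨y, ⟨h1, h2, h⟩, rfl⟩)
    · exact (min_le_right _ _).trans h
end

section
/- Assume Assumption 2.2 and let γ = −inf{v'y : y ∈ ℝⁿ, Ky ≥ 0, ‖Ry‖ ≤ 1} and η = sup{‖y‖ : y ∈ ℝⁿ, Ky ≥ 0, ‖Ry‖ ≤ 1, v'y ≤ 0}. Then γ and η are finite and nonnegative, and for every λ > 0 one has inf{v'y : y ∈ ℝⁿ, Ky ≥ 0, ‖Ry‖ ≤ λ} = −λγ and sup{‖y‖ : y ∈ ℝⁿ, Ky ≥ 0, ‖Ry‖ ≤ λ, v'y ≤ 0} = λη. (Corollary A.1) -/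
open Matrix

/-- The Euclidean norm of a vector in `ℝᵏ`. -/
noncomputable def euclNorm {k : ℕ} (x : Fin k → ℝ) : ℝ :=
  ‖(WithLp.equiv 2 (Fin k → ℝ)).symm x‖

open scoped Pointwise

theorem euclNorm_continuous {k : ℕ} : Continuous (euclNorm : (Fin k → ℝ) → ℝ) := by
  unfold euclNorm
  exact continuous_norm.comp (PiLp.continuous_toLp 2 _)

theorem euclNorm_smul {k : ℕ} (c : ℝ) (hc : 0 ≤ c) (x : Fin k → ℝ) :
    euclNorm (c • x) = c * euclNorm x := by
  unfold euclNorm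
  have : (WithLp.equiv 2 (Fin k → ℝ)).symm (c • x)
      = c • (WithLp.equiv 2 (Fin k → ℝ)).symm x := rfl
  rw [this, norm_smul, Real.norm_of_nonneg hc]

theorem euclNorm_nonneg {k : ℕ} (x : Fin k → ℝ) : 0 ≤ euclNorm x := norm_nonneg _

theorem euclNorm_zero {k : ℕ} : euclNorm (0 : Fin k → ℝ) = 0 := by
  have := euclNorm_smul 0 le_rfl (0 : Fin k → ℝ)
  simpa using this

theorem euclNorm_eq_zero {k : ℕ} (x : Fin k → ℝ) (h : euclNorm x = 0) : x = 0 := by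
  unfold euclNorm at h
  rw [norm_eq_zero] at h
  exact congrArg (WithLp.equiv 2 (Fin k → ℝ)) h

theorem cone_bound {m n p : ℕ}
    (R : Matrix (Fin m) (Fin n) ℝ) (K : Matrix (Fin p) (Fin n) ℝ) (v : Fin n → ℝ)
    (hA : ∀ y : Fin n → ℝ, (∀ i, 0 ≤ (K *ᵥ y) i) → R *ᵥ y = 0 → v ⬝ᵥ y ≤ 0 → y = 0) :
    ∃ B : ℝ, ∀ y : Fin n → ℝ, (∀ i, 0 ≤ (K *ᵥ y) i) → euclNorm (R *ᵥ y) ≤ 1 →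
      v ⬝ᵥ y ≤ 0 → y ∈ Metric.closedBall (0 : Fin n → ℝ) B := by
  have hcR : Continuous fun y : Fin n → ℝ => euclNorm (R *ᵥ y) :=
    euclNorm_continuous.comp (by fun_prop)
  let C : Set (Fin n → ℝ) := Metric.sphere 0 1 ∩ ({y | ∀ i, 0 ≤ (K *ᵥ y) i} ∩ {y | v ⬝ᵥ y ≤ 0})
  have hC : IsCompact C := by
    refine (isCompact_sphere _ _).inter_right (IsClosed.inter ?_ ?_)
    · rw [Set.setOf_forall]
      refine isClosed_iInter fun i => isClosed_le continuous_const ?_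
      exact (continuous_apply i).comp (by fun_prop : Continuous fun y : Fin n → ℝ => K *ᵥ y)
    · exact isClosed_le (by fun_prop) continuous_const
  obtain ⟨d, hd, hdC⟩ : ∃ d : ℝ, 0 < d ∧ ∀ y ∈ C, d ≤ euclNorm (R *ᵥ y) := by
    rcases C.eq_empty_or_nonempty with h | h
    · exact ⟨1, one_pos, by simp [h]⟩
    · obtain ⟨z, hz, hmin⟩ := hC.exists_isMinOn h hcR.continuousOn
      refine ⟨_, lt_of_le_of_ne (euclNorm_nonneg (R *ᵥ z)) ?_, fun y hy => hmin hy⟩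
      intro h0
      have hz0 := hA z hz.2.1 (euclNorm_eq_zero _ h0.symm) hz.2.2
      have := hz.1
      simp [hz0] at this
  refine ⟨1 / d, fun y hK hR hv => ?_⟩
  rw [mem_closedBall_zero_iff]
  by_cases hy : y = 0
  · subst hy
    simp [hd.le]
  have hpos : 0 < ‖y‖ := norm_pos_iff.2 hy
  have hi : 0 ≤ ‖y‖⁻¹ := (inv_pos.2 hpos).le
  have hm : ‖y‖⁻¹ • y ∈ C := by
    refine ⟨?_, ?_, ?_⟩
    · rw [mem_sphere_zero_iff_norm, norm_smul, norm_inv, norm_norm, inv_mul_cancel₀ hpos.ne']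
    · intro i
      rw [Matrix.mulVec_smul]
      exact mul_nonneg hi (hK i)
    · change v ⬝ᵥ _ ≤ 0
      rw [dotProduct_smul]
      exact mul_nonpos_of_nonneg_of_nonpos hi hv
  have h1 := hdC _ hm
  rw [Matrix.mulVec_smul, euclNorm_smul _ hi] at h1
  have h2 : d ≤ ‖y‖⁻¹ := h1.trans (mul_le_of_le_one_right hi hR)
  rw [one_div]
  exact (le_inv_comm₀ hd hpos).1 h2

/-- Corollary A.1: with `γ = -inf{v'y : Ky ≥ 0, ‖Ry‖ ≤ 1}` and
`η = sup{‖y‖ : Ky ≥ 0, ‖Ry‖ ≤ 1, v'y ≤ 0}`, both are finite and nonnegative and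
the infimum/supremum scale linearly in the bound `λ` on `‖Ry‖`. -/
theorem stmt_6 (m n p : ℕ) (hm : 0 < m) (hn : 0 < n) (hp : 0 < p)
    (R : Matrix (Fin m) (Fin n) ℝ) (K : Matrix (Fin p) (Fin n) ℝ) (v : Fin n → ℝ)
    -- Assumption 2.2 (no-arbitrage)
    (hA : ∀ y : Fin n → ℝ, (∀ i, 0 ≤ (K *ᵥ y) i) → R *ᵥ y = 0 → v ⬝ᵥ y ≤ 0 → y = 0)
    (γ η : ℝ)
    (hγ : γ = -sInf {c : ℝ | ∃ y : Fin n → ℝ,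
        (∀ i, 0 ≤ (K *ᵥ y) i) ∧ euclNorm (R *ᵥ y) ≤ 1 ∧ v ⬝ᵥ y = c})
    (hη : η = sSup {c : ℝ | ∃ y : Fin n → ℝ,
        (∀ i, 0 ≤ (K *ᵥ y) i) ∧ euclNorm (R *ᵥ y) ≤ 1 ∧ v ⬝ᵥ y ≤ 0 ∧ euclNorm y = c}) :
    -- finiteness of the infimum and supremum
    BddBelow {c : ℝ | ∃ y : Fin n → ℝ,
        (∀ i, 0 ≤ (K *ᵥ y) i) ∧ euclNorm (R *ᵥ y) ≤ 1 ∧ v ⬝ᵥ y = c} ∧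
    BddAbove {c : ℝ | ∃ y : Fin n → ℝ,
        (∀ i, 0 ≤ (K *ᵥ y) i) ∧ euclNorm (R *ᵥ y) ≤ 1 ∧ v ⬝ᵥ y ≤ 0 ∧ euclNorm y = c} ∧
    0 ≤ γ ∧ 0 ≤ η ∧
    (∀ lam : ℝ, 0 < lam →
      sInf {c : ℝ | ∃ y : Fin n → ℝ,
          (∀ i, 0 ≤ (K *ᵥ y) i) ∧ euclNorm (R *ᵥ y) ≤ lam ∧ v ⬝ᵥ y = c} = -(lam * γ) ∧
      sSup {c : ℝ | ∃ y : Fin n → ℝ,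
          (∀ i, 0 ≤ (K *ᵥ y) i) ∧ euclNorm (R *ᵥ y) ≤ lam ∧ v ⬝ᵥ y ≤ 0 ∧ euclNorm y = c}
        = lam * η) := by
  obtain ⟨B, hB⟩ := cone_bound R K v hA
  have hbb : BddBelow {c : ℝ | ∃ y : Fin n → ℝ,
        (∀ i, 0 ≤ (K *ᵥ y) i) ∧ euclNorm (R *ᵥ y) ≤ 1 ∧ v ⬝ᵥ y = c} := by
    obtain ⟨b, hb⟩ := (isCompact_closedBall (0 : Fin n → ℝ) B).bddBelow_image
      (f := fun y => v ⬝ᵥ y) (by fun_prop)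
    refine ⟨min b 0, ?_⟩
    rintro c ⟨y, hK, hR, rfl⟩
    rcases le_total (v ⬝ᵥ y) 0 with h | h
    · exact (min_le_left _ _).trans (hb ⟨y, hB y hK hR h, rfl⟩)
    · exact (min_le_right _ _).trans h
  have hba : BddAbove {c : ℝ | ∃ y : Fin n → ℝ,
        (∀ i, 0 ≤ (K *ᵥ y) i) ∧ euclNorm (R *ᵥ y) ≤ 1 ∧ v ⬝ᵥ y ≤ 0 ∧ euclNorm y = c} := by
    obtain ⟨b, hb⟩ := (isCompact_closedBall (0 : Fin n → ℝ) B).bddAbove_image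
      (f := euclNorm) euclNorm_continuous.continuousOn
    refine ⟨b, ?_⟩
    rintro c ⟨y, hK, hR, h, rfl⟩
    exact hb ⟨y, hB y hK hR h, rfl⟩
  refine ⟨hbb, hba, ?_, ?_, ?_⟩
  · rw [hγ, neg_nonneg]
    exact csInf_le hbb ⟨0, by simp, by simp [euclNorm_zero], by simp⟩
  · rw [hη]
    exact le_csSup hba ⟨0, by simp, by simp [euclNorm_zero], by simp, euclNorm_zero⟩
  · intro lam hl
    -- scaling facts
    have sK : ∀ (a : ℝ) (y : Fin n → ℝ), 0 ≤ a → (∀ i, 0 ≤ (K *ᵥ y) i) →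
        ∀ i, 0 ≤ (K *ᵥ (a • y)) i := by
      intro a y ha hK i
      rw [Matrix.mulVec_smul]
      exact mul_nonneg ha (hK i)
    have sR : ∀ (y : Fin n → ℝ), euclNorm (R *ᵥ y) ≤ 1 → euclNorm (R *ᵥ (lam • y)) ≤ lam := by
      intro y h
      rw [Matrix.mulVec_smul, euclNorm_smul _ hl.le]
      exact mul_le_of_le_one_right hl.le h
    have hli : 0 ≤ lam⁻¹ := (inv_pos.2 hl).le
    have sR' : ∀ (y : Fin n → ℝ), euclNorm (R *ᵥ y) ≤ lam → euclNorm (R *ᵥ (lam⁻¹ • y)) ≤ 1 := by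
      intro y h
      rw [Matrix.mulVec_smul, euclNorm_smul _ hli]
      calc lam⁻¹ * euclNorm (R *ᵥ y) ≤ lam⁻¹ * lam := mul_le_mul_of_nonneg_left h hli
        _ = 1 := inv_mul_cancel₀ hl.ne'
    have sv : ∀ (a : ℝ) (y : Fin n → ℝ), v ⬝ᵥ (a • y) = a * (v ⬝ᵥ y) := by
      intro a y
      rw [dotProduct_smul, smul_eq_mul]
    constructor
    · rw [hγ, mul_neg, neg_neg, ← smul_eq_mul, ← Real.sInf_smul_of_nonneg hl.le]
      congr 1
      ext c
      rw [Set.mem_smul_set]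
      constructor
      · rintro ⟨y, hK, hR, rfl⟩
        exact ⟨_, ⟨lam⁻¹ • y, sK _ _ hli hK, sR' y hR, rfl⟩, by
          rw [sv, smul_eq_mul, mul_inv_cancel_left₀ hl.ne']⟩
      · rintro ⟨_, ⟨y, hK, hR, rfl⟩, rfl⟩
        exact ⟨lam • y, sK _ _ hl.le hK, sR y hR, sv _ _⟩
    · rw [hη, ← smul_eq_mul, ← Real.sSup_smul_of_nonneg hl.le]
      congr 1
      ext c
      rw [Set.mem_smul_set]
      constructor
      · rintro ⟨y, hK, hR, hv, rfl⟩
        exact ⟨_, ⟨lam⁻¹ • y, sK _ _ hli hK, sR' y hR, by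
          rw [sv]; exact mul_nonpos_of_nonneg_of_nonpos hli hv, rfl⟩, by
          rw [euclNorm_smul _ hli, smul_eq_mul, mul_inv_cancel_left₀ hl.ne']⟩
      · rintro ⟨_, ⟨y, hK, hR, hv, rfl⟩, rfl⟩
        exact ⟨lam • y, sK _ _ hl.le hK, sR y hR, by
          rw [sv]; exact mul_nonpos_of_nonneg_of_nonpos hl.le hv, euclNorm_smul _ hl.le _⟩
end

section
/- For any real m×n matrix R and real p×n matrix K, the set V = {Ry : y ∈ ℝⁿ, Ky ≥ 0} is a closed subset of ℝᵐ. (Claim used in the proof of Lemma A.2: the linear image of the polyhedral cone {y : Ky ≥ 0} is closed) -/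
open Matrix

theorem exists_between_finsets (s t : Finset ℝ) (h : ∀ a ∈ s, ∀ b ∈ t, a ≤ b) :
    ∃ c, (∀ a ∈ s, a ≤ c) ∧ ∀ b ∈ t, c ≤ b := by
  rcases t.eq_empty_or_nonempty with rfl | ht
  · obtain ⟨c, hc⟩ := s.bddAbove
    exact ⟨c, fun a ha => hc ha, by simp⟩
  · exact ⟨t.min' ht, fun a ha => h a ha _ (t.min'_mem ht), fun b hb => t.min'_le b hb⟩

noncomputable def fmC {ι : Type} (b : ι → ℝ) (q : ι × ι) : ℝ :=
  if b q.1 = 0 then 1 else if 0 < b q.1 ∧ b q.2 < 0 then - b q.2 else 0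

noncomputable def fmD {ι : Type} (b : ι → ℝ) (q : ι × ι) : ℝ :=
  if 0 < b q.1 ∧ b q.2 < 0 then b q.1 else 0

theorem fm_elim {ι : Type} [Fintype ι] (b L : ι → ℝ) :
    (∃ t : ℝ, ∀ i, 0 ≤ L i + b i * t) ↔
      ∀ q : ι × ι, 0 ≤ fmC b q * L q.1 + fmD b q * L q.2 := by
  constructor
  · rintro ⟨t, ht⟩ ⟨i, k⟩
    have hi := ht i
    have hk := ht k
    simp only [fmC, fmD]
    by_cases h0 : b i = 0
    · simp [h0] at hi ⊢
      exact hi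
    · by_cases h1 : 0 < b i ∧ b k < 0
      · simp only [h0, h1, if_true, if_false, and_self]
        nlinarith [mul_nonneg h1.1.le hk, mul_nonneg (neg_nonneg.2 h1.2.le) hi]
      · simp [h0, h1]
  · intro h
    classical
    obtain ⟨t, h1, h2⟩ := exists_between_finsets
      ((Finset.univ.filter fun i => 0 < b i).image fun i => -L i / b i)
      ((Finset.univ.filter fun i => b i < 0).image fun i => -L i / b i) (by
        simp only [Finset.mem_image, Finset.mem_filter, Finset.mem_univ, true_and]
        rintro _ ⟨i, hi, rfl⟩ _ ⟨k, hk, rfl⟩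
        have := h (i, k)
        simp only [fmC, fmD, hi.ne', hi, hk, if_true, if_false, and_self] at this
        rw [div_le_iff₀ hi, div_mul_eq_mul_div, le_div_iff_of_neg hk]
        linarith)
    simp only [Finset.mem_image, Finset.mem_filter, Finset.mem_univ, true_and,
      forall_exists_index, and_imp, forall_apply_eq_imp_iff₂] at h1 h2
    refine ⟨t, fun i => ?_⟩
    rcases lt_trichotomy (b i) 0 with hb | hb | hb
    · have := h2 i hb
      rw [le_div_iff_of_neg hb] at this
      linarith
    · have := h (i, i)
      simp [fmC, fmD, hb] at this
      simpa [hb] using this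
    · have := h1 i hb
      rw [div_le_iff₀ hb] at this
      linarith

theorem fm_closed {E : Type} [TopologicalSpace E] (n : ℕ) :
    ∀ (ι : Type) [Fintype ι] (f : ι → E → ℝ) (_ : ∀ i, Continuous (f i))
      (B : ι → Fin n → ℝ),
      IsClosed {x : E | ∃ y : Fin n → ℝ, ∀ i, 0 ≤ f i x + ∑ j, B i j * y j} := by
  induction n with
  | zero =>
    intro ι _ f hf B
    simp only [Finset.univ_eq_empty, Finset.sum_empty, add_zero, exists_const, Set.ofPred_forall]
    exact isClosed_iInter fun i => isClosed_le continuous_const (hf i)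
  | succ n ih =>
    intro ι _ f hf B
    let b : ι → ℝ := fun i => B i 0
    have := ih (ι × ι) (fun q x => fmC b q * f q.1 x + fmD b q * f q.2 x)
      (fun q => ((hf _).const_mul _).add ((hf _).const_mul _))
      (fun q j => fmC b q * B q.1 j.succ + fmD b q * B q.2 j.succ)
    convert this using 1
    ext x
    simp only [Set.mem_ofPred_eq]
    have key : ∀ y : Fin n → ℝ, (∃ t : ℝ, ∀ i, 0 ≤ (f i x + ∑ j, B i j.succ * y j) + b i * t) ↔
        ∀ q : ι × ι, 0 ≤ fmC b q * f q.1 x + fmD b q * f q.2 x +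
          ∑ j, (fmC b q * B q.1 j.succ + fmD b q * B q.2 j.succ) * y j := by
      intro y
      rw [fm_elim]
      refine forall_congr' fun q => ?_
      simp only [add_mul, Finset.sum_add_distrib, mul_add, Finset.mul_sum, mul_assoc]
      rw [add_add_add_comm]
    simp only [← key]
    constructor
    · rintro ⟨y, hy⟩
      refine ⟨fun j => y j.succ, y 0, fun i => ?_⟩
      have := hy i
      rw [Fin.sum_univ_succ] at this
      simp only [b]
      linarith
    · rintro ⟨y, t, hy⟩
      refine ⟨Fin.cons t y, fun i => ?_⟩
      have := hy i
      rw [Fin.sum_univ_succ]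
      simp only [b, Fin.cons_zero, Fin.cons_succ] at this ⊢
      linarith

/-- Claim used in the proof of Lemma A.2: the linear image
`V = {Ry : Ky ≥ 0}` of the polyhedral cone `{y : Ky ≥ 0}` is closed in `ℝᵐ`. -/
theorem stmt_7 (m n p : ℕ) (hm : 0 < m) (hn : 0 < n) (hp : 0 < p)
    (R : Matrix (Fin m) (Fin n) ℝ) (K : Matrix (Fin p) (Fin n) ℝ) :
    IsClosed {x : Fin m → ℝ | ∃ y : Fin n → ℝ, (∀ i, 0 ≤ (K *ᵥ y) i) ∧ R *ᵥ y = x} := by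
  have := fm_closed (E := Fin m → ℝ) n (Fin p ⊕ (Fin m ⊕ Fin m))
    (Sum.elim (fun _ _ => 0) (Sum.elim (fun i x => x i) (fun i x => - x i)))
    (by
      rintro (i | i | i)
      · exact continuous_const
      · exact continuous_apply i
      · exact (continuous_apply i).neg)
    (Sum.elim K (Sum.elim (fun i j => - R i j) R))
  convert this using 1
  ext x
  simp only [Set.mem_ofPred_eq, Sum.forall, Sum.elim_inl, Sum.elim_inr, zero_add,
    funext_iff, Matrix.mulVec, dotProduct]
  refine exists_congr fun y => and_congr Iff.rfl ?_
  rw [← forall_and]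
  refine forall_congr' fun i => ?_
  change _ ↔ 0 ≤ x i + ∑ j, (- R i j) * y j ∧ 0 ≤ - x i + ∑ j, R i j * y j
  simp only [neg_mul, Finset.sum_neg_distrib]
  constructor
  · intro h
    constructor <;> linarith
  · rintro ⟨h1, h2⟩
    linarith
end

section
/- Assume Assumption 2.1, i.e., {Ry : y ∈ ℝⁿ, Ky ≥ 0} = ℝᵐ. Then there exists a finite constant C ≥ 0 such that for every x ∈ ℝᵐ there is y ∈ ℝⁿ with Ry = x, Ky ≥ 0, and ‖y‖ ≤ C‖x‖. (Selection with linear growth, established in the proof of Theorem A.1 via equations (109)–(112)) -/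
open Matrix

/-- Selection with linear growth (from the proof of Theorem A.1, (109)–(112)):
under Assumption 2.1 there is a constant `C ≥ 0` such that every `x ∈ ℝᵐ` can be
written as `x = Ry` with `Ky ≥ 0` and `‖y‖ ≤ C‖x‖`. -/
theorem stmt_8 (m n p : ℕ) (hm : 0 < m) (hn : 0 < n) (hp : 0 < p)
    (R : Matrix (Fin m) (Fin n) ℝ) (K : Matrix (Fin p) (Fin n) ℝ)
    -- Assumption 2.1
    (hA : {x : Fin m → ℝ | ∃ y : Fin n → ℝ, (∀ i, 0 ≤ (K *ᵥ y) i) ∧ R *ᵥ y = x} = Set.univ) :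
    ∃ C : ℝ, 0 ≤ C ∧ ∀ x : Fin m → ℝ, ∃ y : Fin n → ℝ,
      R *ᵥ y = x ∧ (∀ i, 0 ≤ (K *ᵥ y) i) ∧ euclNorm y ≤ C * euclNorm x := by
  have h : ∀ x : Fin m → ℝ, ∃ y : Fin n → ℝ, (∀ i, 0 ≤ (K *ᵥ y) i) ∧ R *ᵥ y = x := by
    intro x
    have hx : x ∈ (Set.univ : Set (Fin m → ℝ)) := Set.mem_univ x
    rw [← hA] at hx
    exact hx
  choose f hf0 hf using h
  let a : Fin m → Fin n → ℝ := fun j => f (Pi.single j 1)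
  let b : Fin m → Fin n → ℝ := fun j => f (-Pi.single j 1)
  refine ⟨∑ j, (euclNorm (a j) + euclNorm (b j)),
    Finset.sum_nonneg fun j _ => add_nonneg (norm_nonneg _) (norm_nonneg _), fun x => ?_⟩
  refine ⟨∑ j, (max (x j) 0 • a j + max (-x j) 0 • b j), ?_, ?_, ?_⟩
  · rw [Matrix.mulVec_sum]
    simp only [Matrix.mulVec_add, Matrix.mulVec_smul, a, b, hf]
    ext i
    simp only [Finset.sum_apply, Pi.add_apply, Pi.smul_apply, Pi.neg_apply, smul_eq_mul]
    rw [Finset.sum_eq_single i]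
    · simp only [Pi.single_eq_same]
      rcases le_total 0 (x i) with h | h
      · rw [max_eq_left h, max_eq_right (by linarith)]; ring
      · rw [max_eq_right h, max_eq_left (by linarith)]; ring
    · intro j _ hj
      rw [Pi.single_eq_of_ne (Ne.symm hj)]; ring
    · simp
  · intro i
    rw [Matrix.mulVec_sum]
    simp only [Matrix.mulVec_add, Matrix.mulVec_smul, Finset.sum_apply, Pi.add_apply,
      Pi.smul_apply, smul_eq_mul]
    exact Finset.sum_nonneg fun j _ => add_nonneg
      (mul_nonneg (le_max_right _ _) (hf0 _ i)) (mul_nonneg (le_max_right _ _) (hf0 _ i))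
  · have hx : ∀ j, |x j| ≤ euclNorm x := fun j =>
      PiLp.norm_apply_le (WithLp.toLp 2 x) j
    have e : euclNorm (∑ j, (max (x j) 0 • a j + max (-x j) 0 • b j)) =
        ‖∑ j, (max (x j) 0 • WithLp.toLp 2 (a j) + max (-x j) 0 • WithLp.toLp 2 (b j))‖ := by
      unfold euclNorm
      simp [WithLp.toLp_sum]
    rw [e, Finset.sum_mul]
    refine (norm_sum_le _ _).trans (Finset.sum_le_sum fun j _ => ?_)
    refine (norm_add_le _ _).trans ?_
    rw [norm_smul, norm_smul, Real.norm_of_nonneg (le_max_right _ _),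
      Real.norm_of_nonneg (le_max_right _ _), add_mul, mul_comm (euclNorm (a j)),
      mul_comm (euclNorm (b j))]
    have h0 : 0 ≤ euclNorm x := norm_nonneg _
    exact add_le_add
      (mul_le_mul_of_nonneg_right (max_le ((le_abs_self _).trans (hx j)) h0) (norm_nonneg _))
      (mul_le_mul_of_nonneg_right (max_le ((neg_le_abs _).trans (hx j)) h0) (norm_nonneg _))
end

section
/- Let 𝒵 ⊂ ℝᵐ be a nonempty compact convex polyhedron, let M : ℝᵐ → ℝ^d be linear, let 𝒲 = {Mz : z ∈ 𝒵}, and let g : 𝒵 → ℝ be continuous and strictly quasiconvex. Then the infimum function ǧ(w) = inf{g(z) : z ∈ 𝒵, Mz = w} is continuous on 𝒲, and there exists a continuous function ψ : 𝒲 → 𝒵 such that Mψ(w) = w and g(ψ(w)) = ǧ(w) for every w ∈ 𝒲. (Lemma A.5, strictly quasiconvex case) -/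
open Matrix

/-- A bounded linear section of a linear map over its range. -/
lemma exists_bdd_section {E F : Type} [NormedAddCommGroup E] [NormedSpace ℝ E]
    [NormedAddCommGroup F] [NormedSpace ℝ F] [FiniteDimensional ℝ F]
    (M : E →ₗ[ℝ] F) :
    ∃ C : ℝ, 0 ≤ C ∧ ∀ x : E, ∃ u : E, M u = M x ∧ ‖u‖ ≤ C * ‖M x‖ := by
  obtain ⟨L, hL⟩ := M.rangeRestrict.exists_rightInverse_of_surjective
    (LinearMap.range_rangeRestrict M)
  refine ⟨‖L.toContinuousLinearMap‖, ContinuousLinearMap.opNorm_nonneg _, fun x => ⟨L (M.rangeRestrict x), ?_, ?_⟩⟩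
  · have := LinearMap.congr_fun hL (M.rangeRestrict x)
    simpa using congrArg Subtype.val this
  · have := L.toContinuousLinearMap.le_opNorm (M.rangeRestrict x)
    simpa using this

/-- Hoffman-type Lipschitz bound for fibres of a linear map on a polyhedron. -/
lemma hoffman {E : Type} [NormedAddCommGroup E] [NormedSpace ℝ E] {ι : Type} [DecidableEq ι]
    (a : ι → E →L[ℝ] ℝ) (b : ι → ℝ) (I : Finset ι) :
    ∀ (F : Type) [NormedAddCommGroup F] [NormedSpace ℝ F] [FiniteDimensional ℝ F]
      (M : E →ₗ[ℝ] F),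
      ∃ K : ℝ, 0 ≤ K ∧ ∀ z₀ z : E, (∀ i ∈ I, a i z₀ ≤ b i) → (∀ i ∈ I, a i z ≤ b i) →
        ∃ z' : E, (∀ i ∈ I, a i z' ≤ b i) ∧ M z' = M z ∧ ‖z' - z₀‖ ≤ K * ‖M z - M z₀‖ := by
  induction I using Finset.strongInduction with
  | H I ih =>
  intro F _ _ _ M
  obtain ⟨C, hC, hsec⟩ := exists_bdd_section M
  have key : ∀ i : ι, ∃ K : ℝ, 0 ≤ K ∧ (i ∈ I → ∀ z₀ z : E,
      (∀ j ∈ I.erase i, a j z₀ ≤ b j) → (∀ j ∈ I.erase i, a j z ≤ b j) →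
        ∃ z' : E, (∀ j ∈ I.erase i, a j z' ≤ b j) ∧ M.prod (a i : E →ₗ[ℝ] ℝ) z' = M.prod (a i : E →ₗ[ℝ] ℝ) z ∧
          ‖z' - z₀‖ ≤ K * ‖M.prod (a i : E →ₗ[ℝ] ℝ) z - M.prod (a i : E →ₗ[ℝ] ℝ) z₀‖) := by
    intro i
    by_cases hi : i ∈ I
    · obtain ⟨K, hK, h⟩ := ih (I.erase i) (Finset.erase_ssubset hi) (F × ℝ) (M.prod (a i : E →ₗ[ℝ] ℝ))
      exact ⟨K, hK, fun _ => h⟩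
    · exact ⟨0, le_rfl, fun h => absurd h hi⟩
  choose K hK hKe using key
  have hnn : ∀ i, 0 ≤ K i * (1 + ‖a i‖ * C) := fun i => by have := hK i; positivity
  refine ⟨C + ∑ i ∈ I, K i * (1 + ‖a i‖ * C), add_nonneg hC (Finset.sum_nonneg fun i _ => hnn i), ?_⟩
  intro z₀ z h0 hz
  obtain ⟨u', hu', hu'n⟩ := hsec (z - z₀)
  rw [map_sub] at hu' hu'n
  by_cases hfe : ∀ i ∈ I, a i (z₀ + u') ≤ b i
  · refine ⟨z₀ + u', hfe, by rw [map_add, hu']; abel, ?_⟩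
    rw [add_sub_cancel_left]
    refine hu'n.trans (mul_le_mul_of_nonneg_right ?_ (norm_nonneg _))
    exact le_add_of_nonneg_right (Finset.sum_nonneg fun i _ => hnn i)
  push Not at hfe
  -- exit time from the feasible set on the segment from `z` to `u`
  set u := z₀ + u' with hu
  set J := I.filter (fun i => b i < a i u) with hJ
  have hJne : J.Nonempty := by
    obtain ⟨i, hi, h⟩ := hfe
    exact ⟨i, by simp [hJ, hi, h]⟩
  obtain ⟨i, hiJ, hmin⟩ := J.exists_min_image (fun i => (b i - a i z) / (a i u - a i z)) hJne
  obtain ⟨hiI, hiu⟩ := Finset.mem_filter.1 hiJ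
  have hiz := hz i hiI
  set t := (b i - a i z) / (a i u - a i z) with ht
  have hden : 0 < a i u - a i z := by linarith
  have ht0 : 0 ≤ t := div_nonneg (by linarith) hden.le
  have ht1 : t ≤ 1 := by rw [ht, div_le_one hden]; linarith
  set v := z + t • (u - z) with hv
  have hav : ∀ j, a j v = a j z + t * (a j u - a j z) := fun j => by simp [hv]
  have hvi : a i v = b i := by
    rw [hav, ht, div_mul_cancel₀ _ hden.ne']; ring
  have hvf : ∀ j ∈ I, a j v ≤ b j := by
    intro j hj
    rw [hav]
    have hjz := hz j hj
    by_cases hju : b j < a j u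
    · have hm := hmin j (Finset.mem_filter.2 ⟨hj, hju⟩)
      change t ≤ _ at hm
      rw [le_div_iff₀ (by linarith)] at hm
      linarith
    · push Not at hju
      nlinarith
  have hMu : M u = M z := by rw [hu, map_add, hu']; abel
  have hMv : M v = M z := by rw [hv, map_add, map_smul, map_sub, hMu]; simp
  obtain ⟨z', hz'f, hz'M, hz'n⟩ := hKe i hiI z₀ v (fun j hj => h0 j (Finset.mem_of_mem_erase hj))
    (fun j hj => hvf j (Finset.mem_of_mem_erase hj))
  have hM1 : M z' = M v := congrArg Prod.fst hz'M
  have hM2 : a i z' = a i v := congrArg Prod.snd hz'M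
  refine ⟨z', ?_, hM1.trans hMv, ?_⟩
  · intro j hj
    by_cases hji : j = i
    · subst hji; rw [hM2, hvi]
    · exact hz'f j (Finset.mem_erase.2 ⟨hji, hj⟩)
  · set D := ‖M z - M z₀‖ with hD
    have hDn : 0 ≤ D := norm_nonneg _
    have hai : |a i v - a i z₀| ≤ ‖a i‖ * C * D := by
      have h1 : a i u - a i z₀ ≤ ‖a i‖ * ‖u'‖ := by
        have := (a i).le_opNorm u'
        rw [hu, map_add, add_sub_cancel_left]
        exact (le_abs_self _).trans this
      have h2 : ‖a i‖ * ‖u'‖ ≤ ‖a i‖ * (C * D) :=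
        mul_le_mul_of_nonneg_left hu'n (norm_nonneg _)
      have := h0 i hiI
      rw [abs_of_nonneg (by linarith)]
      linarith
    have hnorm : ‖M.prod (a i : E →ₗ[ℝ] ℝ) v - M.prod (a i : E →ₗ[ℝ] ℝ) z₀‖ ≤ (1 + ‖a i‖ * C) * D := by
      have hp : 0 ≤ ‖a i‖ * C * D := by positivity
      have e : M.prod (a i : E →ₗ[ℝ] ℝ) v - M.prod (a i : E →ₗ[ℝ] ℝ) z₀ = (M v - M z₀, a i v - a i z₀) := rfl
      rw [e, Prod.norm_mk, hMv, Real.norm_eq_abs]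
      refine max_le ?_ ?_ <;> linarith
    calc ‖z' - z₀‖ ≤ K i * ((1 + ‖a i‖ * C) * D) :=
          hz'n.trans (mul_le_mul_of_nonneg_left hnorm (hK i))
      _ = (K i * (1 + ‖a i‖ * C)) * D := by ring
      _ ≤ _ := by
        refine mul_le_mul_of_nonneg_right ?_ hDn
        have := Finset.single_le_sum (f := fun i => K i * (1 + ‖a i‖ * C)) (fun i _ => hnn i) hiI
        linarith

/-- Lemma A.5, strictly quasiconvex case: on a nonempty compact convex
polyhedron `𝒵`, for a continuous strictly quasiconvex `g`, the infimum function
`ǧ(w) = inf{g(z) : z ∈ 𝒵, Mz = w}` is continuous on `𝒲 = M(𝒵)` and admits a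
continuous selection `ψ` of minimizers. -/
theorem stmt_14 (mm dd : ℕ) (Zset : Set (Fin mm → ℝ))
    (l : ℕ) (a : Fin l → Fin mm → ℝ) (b : Fin l → ℝ)
    -- `𝒵` is a nonempty compact convex polyhedron
    (hZpoly : Zset = {z : Fin mm → ℝ | ∀ i : Fin l, z ⬝ᵥ a i ≤ b i})
    (hZbdd : Bornology.IsBounded Zset) (hZne : Zset.Nonempty)
    (M : (Fin mm → ℝ) →ₗ[ℝ] (Fin dd → ℝ))
    (g : (Fin mm → ℝ) → ℝ) (hgc : ContinuousOn g Zset)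
    -- `g` is strictly quasiconvex on `𝒵`
    (hgsq : ∀ z₁ ∈ Zset, ∀ z₂ ∈ Zset, z₁ ≠ z₂ → ∀ lam : ℝ, 0 < lam → lam < 1 →
      g (lam • z₁ + (1 - lam) • z₂) < max (g z₁) (g z₂)) :
    ContinuousOn (fun w => sInf (g '' {z ∈ Zset | M z = w})) (M '' Zset) ∧
    ∃ ψ : (Fin dd → ℝ) → (Fin mm → ℝ), ContinuousOn ψ (M '' Zset) ∧
      ∀ w ∈ M '' Zset, ψ w ∈ Zset ∧ M (ψ w) = w ∧
        g (ψ w) = sInf (g '' {z ∈ Zset | M z = w}) := by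
  classical
  have hcl : IsClosed Zset := by
    rw [hZpoly, Set.ofPred_forall]
    refine isClosed_iInter fun i => isClosed_le ?_ continuous_const
    simp only [dotProduct]
    fun_prop
  have hcomp : IsCompact Zset := Metric.isCompact_of_isClosed_isBounded hcl hZbdd
  have hMc : Continuous M := M.continuous_of_finiteDimensional
  have hconv : ∀ x ∈ Zset, ∀ y ∈ Zset, (1/2 : ℝ) • x + (1 - 1/2 : ℝ) • y ∈ Zset := by
    intro x hx y hy
    rw [hZpoly] at hx hy ⊢
    intro i
    have h1 := hx i
    have h2 := hy i
    rw [add_dotProduct, smul_dotProduct, smul_dotProduct, smul_eq_mul, smul_eq_mul]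
    linarith
  -- Lipschitz lifting
  have hlift : ∃ K : ℝ, 0 ≤ K ∧ ∀ z₀ ∈ Zset, ∀ w ∈ M '' Zset, ∃ z' ∈ Zset, M z' = w ∧
      ‖z' - z₀‖ ≤ K * ‖w - M z₀‖ := by
    let A : Fin l → (Fin mm → ℝ) →L[ℝ] ℝ := fun i =>
      LinearMap.toContinuousLinearMap
        { toFun := fun z => z ⬝ᵥ a i
          map_add' := fun x y => add_dotProduct _ _ _
          map_smul' := fun c x => smul_dotProduct _ _ _ }
    obtain ⟨K, hK, h⟩ := hoffman A b Finset.univ (Fin dd → ℝ) M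
    have hmem : ∀ z, z ∈ Zset ↔ ∀ i ∈ Finset.univ, A i z ≤ b i := by
      intro z
      rw [hZpoly]
      simp [A]
    refine ⟨K, hK, ?_⟩
    rintro z₀ hz₀ _ ⟨z, hz, rfl⟩
    obtain ⟨z', h1, h2, h3⟩ := h z₀ z ((hmem _).1 hz₀) ((hmem _).1 hz)
    exact ⟨z', (hmem _).2 h1, h2, h3⟩
  obtain ⟨K, hK, hlift⟩ := hlift
  -- minimizers
  have hex : ∀ w, ∃ z, w ∈ M '' Zset → z ∈ Zset ∧ M z = w ∧
      ∀ y ∈ Zset, M y = w → g z ≤ g y := by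
    intro w
    by_cases hw : w ∈ M '' Zset
    · obtain ⟨x, hx, hxw⟩ := hw
      have hc : IsCompact (Zset ∩ M ⁻¹' {w}) :=
        hcomp.inter_right (isClosed_singleton.preimage hMc)
      obtain ⟨z, hz, hmin⟩ := hc.exists_isMinOn ⟨x, hx, hxw⟩ (hgc.mono Set.inter_subset_left)
      exact ⟨z, fun _ => ⟨hz.1, hz.2, fun y hy hyw => hmin ⟨hy, hyw⟩⟩⟩
    · exact ⟨0, fun h => absurd h hw⟩
  choose ψ hψ using hex
  have hval : ∀ w ∈ M '' Zset, g (ψ w) = sInf (g '' {z ∈ Zset | M z = w}) := by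
    intro w hw
    obtain ⟨h1, h2, h3⟩ := hψ w hw
    have hl : IsLeast (g '' {z ∈ Zset | M z = w}) (g (ψ w)) := by
      refine ⟨⟨ψ w, ⟨h1, h2⟩, rfl⟩, ?_⟩
      rintro _ ⟨y, ⟨hy, hyw⟩, rfl⟩
      exact h3 y hy hyw
    exact hl.csInf_eq.symm
  have hcont : ContinuousOn ψ (M '' Zset) := by
    intro w₀ hw₀
    obtain ⟨h1, h2, h3⟩ := hψ w₀ hw₀
    have hself : ∀ᶠ w in nhdsWithin w₀ (M '' Zset), w ∈ M '' Zset := self_mem_nhdsWithin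
    refine hcomp.tendsto_nhds_of_unique_mapClusterPt (hself.mono fun w hw => (hψ w hw).1) ?_
    intro y hy hcy
    have hMy : M y = w₀ := by
      by_contra hne
      obtain ⟨U, V, hU, hV, hyU, hwV, hd⟩ := t2_separation hne
      have hf : ∃ᶠ w in nhdsWithin w₀ (M '' Zset), ψ w ∈ M ⁻¹' U :=
        hcy.frequently ((hU.preimage hMc).mem_nhds hyU)
      have hV' : ∀ᶠ w in nhdsWithin w₀ (M '' Zset), w ∈ V :=
        nhdsWithin_le_nhds (hV.mem_nhds hwV)
      obtain ⟨w, hw1, hw2, hw3⟩ := (hf.and_eventually (hV'.and hself)).exists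
      have : M (ψ w) ∈ U := hw1
      rw [(hψ w hw3).2.1] at this
      exact Set.disjoint_left.1 hd this hw2
    have hgy : g y ≤ g (ψ w₀) := by
      by_contra! hlt
      obtain ⟨c, hc1, hc2⟩ := exists_between hlt
      have e1 : ∀ᶠ z in nhdsWithin (ψ w₀) Zset, g z < c :=
        (hgc _ h1).eventually (gt_mem_nhds hc1)
      have e2 : ∀ᶠ z in nhdsWithin y Zset, c < g z :=
        (hgc _ hy).eventually (lt_mem_nhds hc2)
      rw [eventually_nhdsWithin_iff] at e2
      obtain ⟨ε, hε, hball⟩ := Metric.mem_nhdsWithin_iff.1 e1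
      have hf := hcy.frequently e2
      have hnear : ∀ᶠ w in nhdsWithin w₀ (M '' Zset), K * ‖w - w₀‖ < ε := by
        have : Filter.Tendsto (fun w => K * ‖w - w₀‖) (nhds w₀) (nhds (K * ‖w₀ - w₀‖)) :=
          Continuous.tendsto (by fun_prop) w₀
        rw [sub_self, norm_zero, mul_zero] at this
        exact nhdsWithin_le_nhds (this.eventually (gt_mem_nhds hε))
      obtain ⟨w, hw1, hw2, hw3⟩ := (hf.and_eventually (hnear.and hself)).exists
      obtain ⟨k1, k2, k3⟩ := hψ w hw3
      obtain ⟨z', hz', hMz', hn⟩ := hlift (ψ w₀) h1 w hw3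
      rw [h2] at hn
      have l1 : g z' < c := hball ⟨by rw [Metric.mem_ball, dist_eq_norm]; linarith, hz'⟩
      have l2 := k3 z' hz' hMz'
      have l3 := hw1 k1
      linarith
    by_contra hne
    have hs := hgsq y hy (ψ w₀) h1 hne (1/2) (by norm_num) (by norm_num)
    have hm := h3 _ (hconv y hy (ψ w₀) h1) (by
      rw [map_add, map_smul, map_smul, hMy, h2, ← add_smul]; norm_num)
    rw [max_eq_right hgy] at hs
    linarith
  refine ⟨?_, ψ, hcont, fun w hw => ⟨(hψ w hw).1, (hψ w hw).2.1, hval w hw⟩⟩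
  refine (hgc.comp hcont fun w hw => (hψ w hw).1).congr fun w hw => (hval w hw).symm
end

section
/- Let 𝒵 ⊂ ℝᵐ be a nonempty compact convex polyhedron, let M : ℝᵐ → ℝ^d be linear, let 𝒲 = {Mz : z ∈ 𝒵}, and let g : 𝒵 → ℝ be affine, i.e., g(z) = z'a + c for some a ∈ ℝᵐ and c ∈ ℝ. Then the infimum function ǧ(w) = inf{g(z) : z ∈ 𝒵, Mz = w} is continuous on 𝒲, and there exists a continuous function ψ : 𝒲 → 𝒵 such that Mψ(w) = w and g(ψ(w)) = ǧ(w) for every w ∈ 𝒲. (Lemma A.5, affine case) -/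
open Matrix

open Topology Filter in
lemma cone_bound_s15 {ι F : Type*} [DecidableEq ι] [NormedAddCommGroup F] [NormedSpace ℝ F]
    (u : ι → F) (n : ℕ) : ∀ s : Finset ι, s.card = n →
    ∃ K : ℝ, 0 ≤ K ∧ ∀ μ : ι → ℝ, (∀ j ∈ s, 0 ≤ μ j) →
      ∃ μ' : ι → ℝ, (∀ j ∈ s, 0 ≤ μ' j) ∧ ∑ j ∈ s, μ' j • u j = ∑ j ∈ s, μ j • u j ∧
        ∀ j ∈ s, μ' j ≤ K * ‖∑ j ∈ s, μ j • u j‖ := by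
  induction n with
  | zero =>
    intro s hs
    rw [Finset.card_eq_zero] at hs
    subst hs
    exact ⟨0, le_rfl, fun μ _ => ⟨μ, by simp, rfl, by simp⟩⟩
  | succ n ih =>
    intro s hs
    by_cases hli : LinearIndependent ℝ (fun j : s => u j)
    · have hinj : Function.Injective (Fintype.linearCombination ℝ (fun j : s => u j)) := by
        exact linearIndependent_iff_injective_fintypeLinearCombination.1 hli
      obtain ⟨K, hK, hanti⟩ := LinearMap.exists_antilipschitzWith
        (LinearMap.codRestrict (LinearMap.range (Fintype.linearCombination ℝ (fun j : s => u j)))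
          (Fintype.linearCombination ℝ (fun j : s => u j)) (fun x => LinearMap.mem_range_self _ x))
        (by
          rw [LinearMap.ker_codRestrict]
          exact LinearMap.ker_eq_bot.2 hinj)
      refine ⟨K, K.2, fun μ hμ => ⟨μ, hμ, rfl, fun j hj => ?_⟩⟩
      have h1 := hanti.le_mul_dist (fun j : s => μ j) 0
      rw [map_zero, dist_zero_right, dist_zero_right] at h1
      have h2 : ‖(LinearMap.codRestrict (LinearMap.range (Fintype.linearCombination ℝ (fun j : s => u j)))
          (Fintype.linearCombination ℝ (fun j : s => u j)) (fun x => LinearMap.mem_range_self _ x))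
            (fun j : s => μ j)‖ = ‖∑ j ∈ s, μ j • u j‖ := by
        rw [Submodule.coe_norm, LinearMap.codRestrict_apply, Fintype.linearCombination_apply,
          ← Finset.sum_coe_sort s (fun j => μ j • u j)]
      rw [h2] at h1
      calc μ j ≤ ‖μ j‖ := le_abs_self _
        _ ≤ ‖(fun j : s => μ j)‖ := norm_le_pi_norm (fun j : s => μ j) ⟨j, hj⟩
        _ ≤ _ := h1
    · have hcard : ∀ i ∈ s, (s.erase i).card = n := fun i hi => by
        rw [Finset.card_erase_of_mem hi, hs]; rfl
      have ih' : ∀ i : ι, ∃ K : ℝ, 0 ≤ K ∧ (i ∈ s → ∀ μ : ι → ℝ, (∀ j ∈ s.erase i, 0 ≤ μ j) →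
        ∃ μ' : ι → ℝ, (∀ j ∈ s.erase i, 0 ≤ μ' j) ∧
          ∑ j ∈ s.erase i, μ' j • u j = ∑ j ∈ s.erase i, μ j • u j ∧
          ∀ j ∈ s.erase i, μ' j ≤ K * ‖∑ j ∈ s.erase i, μ j • u j‖) := by
        intro i
        by_cases hi : i ∈ s
        · obtain ⟨K, hK, h⟩ := ih (s.erase i) (hcard i hi)
          exact ⟨K, hK, fun _ => h⟩
        · exact ⟨0, le_rfl, fun h => absurd h hi⟩
      choose K hK0 hK using ih'
      have hν : ∃ ν : ι → ℝ, ∑ j ∈ s, ν j • u j = 0 ∧ ∃ j ∈ s, 0 < ν j := by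
        rw [Fintype.not_linearIndependent_iff] at hli
        obtain ⟨ν, hν, ⟨i, hi⟩, hne⟩ := hli
        let ν' : ι → ℝ := fun j => if h : j ∈ s then ν ⟨j, h⟩ else 0
        have hs' : ∑ j ∈ s, ν' j • u j = 0 := by
          rw [← Finset.sum_coe_sort, ← hν]
          refine Finset.sum_congr rfl fun j _ => ?_
          simp [ν']
        have hi' : ν' i = ν ⟨i, hi⟩ := by simp [ν', hi]
        rcases lt_or_gt_of_ne hne with h | h
        · refine ⟨-ν', by simp [hs'], i, hi, ?_⟩
          rw [Pi.neg_apply, hi']; linarith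
        · exact ⟨ν', hs', i, hi, by rw [hi']; exact h⟩
      obtain ⟨ν, hν0, j0, hj0, hj0p⟩ := hν
      refine ⟨∑ i ∈ s, K i, Finset.sum_nonneg fun i _ => hK0 i, fun μ hμ => ?_⟩
      obtain ⟨i, hi, hmin⟩ := (s.filter (fun j => 0 < ν j)).exists_min_image (fun j => μ j / ν j)
        ⟨j0, by simp [hj0, hj0p]⟩
      rw [Finset.mem_filter] at hi
      obtain ⟨his, hip⟩ := hi
      set t := μ i / ν i with ht
      have ht0 : 0 ≤ t := div_nonneg (hμ i his) hip.le
      have hρ : ∀ j ∈ s, 0 ≤ μ j - t * ν j := by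
        intro j hj
        by_cases hjp : 0 < ν j
        · have := hmin j (by simp [hj, hjp])
          rw [le_div_iff₀ hjp] at this
          linarith
        · have := hμ j hj
          nlinarith
      have hρi : μ i - t * ν i = 0 := by rw [ht]; field_simp; ring
      have hsum : ∑ j ∈ s.erase i, (μ j - t * ν j) • u j = ∑ j ∈ s, μ j • u j := by
        rw [Finset.sum_erase _ (by rw [hρi, zero_smul])]
        simp only [sub_smul, mul_smul, Finset.sum_sub_distrib, ← Finset.smul_sum, hν0]
        simp
      obtain ⟨μ', h1, h2, h3⟩ := hK i his (fun j => μ j - t * ν j)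
        (fun j hj => hρ j (Finset.mem_of_mem_erase hj))
      simp only [hsum] at h2 h3
      have hle : K i ≤ ∑ i ∈ s, K i := Finset.single_le_sum (fun i _ => hK0 i) his
      refine ⟨fun j => if j = i then 0 else μ' j, ?_, ?_, ?_⟩
      · intro j hj
        by_cases h : j = i
        · simp [h]
        · simpa [h] using h1 j (by simp [h, hj])
      · rw [← h2, ← Finset.sum_erase (a := i) s (by simp)]
        refine Finset.sum_congr rfl fun j hj => ?_
        simp [Finset.ne_of_mem_erase hj]
      · intro j hj
        by_cases h : j = i
        · simp only [h, if_true]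
          exact mul_nonneg ((hK0 i).trans hle) (norm_nonneg _)
        · simp only [h, if_false]
          exact (h3 j (by simp [h, hj])).trans (mul_le_mul_of_nonneg_right hle (norm_nonneg _))

open Topology Filter in
lemma finite_extreme (mm l : ℕ) (aa : Fin l → Fin mm → ℝ) (bb : Fin l → ℝ) :
    (Set.extremePoints ℝ {z : Fin mm → ℝ | ∀ i : Fin l, z ⬝ᵥ aa i ≤ bb i}).Finite := by
  refine Set.Finite.of_finite_image (f := fun z : Fin mm → ℝ => {i : Fin l | z ⬝ᵥ aa i = bb i})
    (Set.toFinite _) ?_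
  intro x hx y hy hxy
  have hact : ∀ i, x ⬝ᵥ aa i = bb i ↔ y ⬝ᵥ aa i = bb i := fun i => by
    have := Set.ext_iff.1 hxy i
    simpa using this
  have hxZ := hx.1
  have key : ∀ᶠ e : ℝ in 𝓝 0, ∀ i, (x + e • (y - x)) ⬝ᵥ aa i ≤ bb i := by
    rw [eventually_all]
    intro i
    by_cases h : x ⬝ᵥ aa i = bb i
    · refine Eventually.of_forall fun e => ?_
      rw [add_dotProduct, smul_dotProduct, sub_dotProduct, (hact i).1 h, h]
      simp
    · have hlt : x ⬝ᵥ aa i < bb i := lt_of_le_of_ne (hxZ i) h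
      have hc : Continuous fun e : ℝ => (x + e • (y - x)) ⬝ᵥ aa i := by
        simp only [add_dotProduct, smul_dotProduct]
        fun_prop
      have := hc.tendsto 0
      simp only [zero_smul, add_zero] at this
      exact (this.eventually_lt_const hlt).mono fun e he => he.le
  have key2 : ∀ᶠ e : ℝ in 𝓝 0, ∀ i, (x + (-e) • (y - x)) ⬝ᵥ aa i ≤ bb i := by
    have : Tendsto (fun e : ℝ => -e) (𝓝 0) (𝓝 0) := by
      simpa using (continuous_neg (G := ℝ)).tendsto 0
    exact this.eventually key
  obtain ⟨e, ⟨he1, he2⟩, hpos⟩ := (((key.and key2).filter_mono nhdsWithin_le_nhds).and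
    (self_mem_nhdsWithin : Set.Ioi (0:ℝ) ∈ 𝓝[>] (0:ℝ))).exists
  have hseg : x ∈ openSegment ℝ (x + e • (y - x)) (x + (-e) • (y - x)) := by
    refine ⟨1/2, 1/2, by norm_num, by norm_num, by norm_num, ?_⟩
    module
  have := (mem_extremePoints.1 hx).2 _ he1 _ he2 hseg
  have h0 : e • (y - x) = 0 := by simpa using this.1
  have he : e ≠ 0 := ne_of_gt hpos
  rcases smul_eq_zero.1 h0 with h | h
  · exact absurd h he
  · exact (sub_eq_zero.1 h).symm

open Topology Filter in
lemma open_map {E F : Type*} [NormedAddCommGroup E] [NormedSpace ℝ E]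
    [NormedAddCommGroup F] [NormedSpace ℝ F] (L : E →ₗ[ℝ] F) (S : Finset E) (z0 : E)
    (hz0 : z0 ∈ convexHull ℝ (S : Set E)) (U : Set E) (hU : U ∈ 𝓝 z0) :
    ∀ᶠ y in 𝓝[L '' (convexHull ℝ (S : Set E))] (L z0),
      ∃ z ∈ convexHull ℝ (S : Set E), z ∈ U ∧ L z = y := by
  classical
  obtain ⟨K, hK0, hK⟩ := cone_bound_s15 (fun v : E => L v - L z0) _ S rfl
  obtain ⟨r, hr, hrU⟩ := Metric.mem_nhds_iff.1 hU
  have hc1 : ∀ᶠ y in 𝓝 (L z0), ∑ v ∈ S, K * ‖y - L z0‖ < 1 := by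
    have hc : Continuous fun y : F => ∑ v ∈ S, K * ‖y - L z0‖ := by fun_prop
    have := hc.tendsto (L z0)
    simp only [sub_self, norm_zero, mul_zero, Finset.sum_const_zero] at this
    exact this.eventually_lt_const one_pos
  have hc2 : ∀ᶠ y in 𝓝 (L z0), ∑ v ∈ S, K * ‖y - L z0‖ * ‖v - z0‖ < r := by
    have hc : Continuous fun y : F => ∑ v ∈ S, K * ‖y - L z0‖ * ‖v - z0‖ := by fun_prop
    have := hc.tendsto (L z0)
    simp only [sub_self, norm_zero, mul_zero, zero_mul, Finset.sum_const_zero] at this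
    exact this.eventually_lt_const hr
  filter_upwards [hc1.filter_mono nhdsWithin_le_nhds, hc2.filter_mono nhdsWithin_le_nhds,
    self_mem_nhdsWithin] with y h1 h2 hy
  obtain ⟨x, hx, rfl⟩ := hy
  obtain ⟨w, hw0, hw1, hwx⟩ := Finset.mem_convexHull'.1 hx
  have hsum : ∑ v ∈ S, w v • (L v - L z0) = L x - L z0 := by
    simp only [smul_sub, Finset.sum_sub_distrib, ← Finset.sum_smul, hw1, one_smul]
    rw [← hwx]; simp
  obtain ⟨μ, hμ0, hμs, hμb⟩ := hK w hw0
  rw [hsum] at hμs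
  simp only [hsum] at hμb
  have hμ1 : ∑ v ∈ S, μ v ≤ 1 := (Finset.sum_le_sum hμb).trans h1.le
  refine ⟨z0 + ∑ v ∈ S, μ v • (v - z0), ?_, ?_, ?_⟩
  · have heq : z0 + ∑ v ∈ S, μ v • (v - z0) = (1 - ∑ v ∈ S, μ v) • z0 + ∑ v ∈ S, μ v • v := by
      simp only [smul_sub, Finset.sum_sub_distrib, ← Finset.sum_smul, sub_smul, one_smul]
      abel
    obtain ⟨w', hw0', hw1', hwx'⟩ := Finset.mem_convexHull'.1 hz0
    rw [heq]
    refine Finset.mem_convexHull'.2 ⟨fun v => (1 - ∑ v ∈ S, μ v) * w' v + μ v, ?_, ?_, ?_⟩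
    · intro v hv
      exact add_nonneg (mul_nonneg (by linarith) (hw0' v hv)) (hμ0 v hv)
    · rw [Finset.sum_add_distrib, ← Finset.mul_sum, hw1']; ring
    · simp only [add_smul, mul_smul, Finset.sum_add_distrib, ← Finset.smul_sum, hwx']
  · apply hrU
    rw [Metric.mem_ball, dist_eq_norm, add_sub_cancel_left]
    refine lt_of_le_of_lt ((norm_sum_le _ _).trans (Finset.sum_le_sum fun v hv => ?_)) h2
    rw [norm_smul, Real.norm_of_nonneg (hμ0 v hv)]
    exact mul_le_mul_of_nonneg_right (hμb v hv) (norm_nonneg _)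
  · simp only [map_add, map_sum, map_smul, map_sub, hμs]
    abel

lemma attained {E F : Type*} [TopologicalSpace E] [TopologicalSpace F] [T1Space F]
    (Z : Set E) (hZ : IsCompact Z) (L : E → F) (hL : Continuous L) (h : E → ℝ)
    (hh : Continuous h) (y : F) (hy : y ∈ L '' Z) :
    ∃ z ∈ Z, L z = y ∧ h z = sInf (h '' {z ∈ Z | L z = y}) ∧
      ∀ z' ∈ Z, L z' = y → h z ≤ h z' := by
  have hc : IsCompact {z ∈ Z | L z = y} := hZ.inter_right (isClosed_singleton.preimage hL)
  obtain ⟨z1, hz1, hz1y⟩ := hy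
  obtain ⟨z, hz, hmin⟩ := hc.exists_isMinOn ⟨z1, hz1, hz1y⟩ hh.continuousOn
  refine ⟨z, hz.1, hz.2, ?_, fun z' h1 h2 => hmin ⟨h1, h2⟩⟩
  have : IsLeast (h '' {z ∈ Z | L z = y}) (h z) := by
    refine ⟨⟨z, hz, rfl⟩, ?_⟩
    rintro _ ⟨z', hz', rfl⟩
    exact hmin hz'
  exact this.csInf_eq.symm

open Topology Filter in
lemma berge {E F : Type*} [TopologicalSpace E] [TopologicalSpace F] [T2Space F]
    (Z : Set E) (hZ : IsCompact Z) (L : E → F) (hL : Continuous L) (h : E → ℝ)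
    (hh : Continuous h)
    (hopen : ∀ z0 ∈ Z, ∀ U ∈ 𝓝 z0, ∀ᶠ y in 𝓝[L '' Z] (L z0), ∃ z ∈ Z, z ∈ U ∧ L z = y) :
    ContinuousOn (fun y => sInf (h '' {z ∈ Z | L z = y})) (L '' Z) := by
  intro y0 hy0
  obtain ⟨z0, hz0, hLz0, hmin0, hle0⟩ := attained Z hZ L hL h hh y0 hy0
  refine tendsto_order.2 ⟨fun c hc => ?_, fun c hc => ?_⟩
  · have hK : IsCompact (Z ∩ {z | h z ≤ c}) := hZ.inter_right (isClosed_le hh continuous_const)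
    have hcl : IsClosed (L '' (Z ∩ {z | h z ≤ c})) := (hK.image hL).isClosed
    have hn : y0 ∉ L '' (Z ∩ {z | h z ≤ c}) := by
      rintro ⟨z, ⟨hz, hzc⟩, hzy⟩
      have h1 := hle0 z hz hzy
      simp only [Set.mem_ofPred_eq] at hzc
      simp only [← hmin0] at hc
      linarith
    filter_upwards [mem_nhdsWithin_of_mem_nhds (hcl.isOpen_compl.mem_nhds hn),
      self_mem_nhdsWithin] with y hy hyZ
    obtain ⟨z, hz, hLz, hmin, hle⟩ := attained Z hZ L hL h hh y hyZ
    rw [← hmin]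
    by_contra hcon
    exact hy ⟨z, ⟨hz, not_lt.1 hcon⟩, hLz⟩
  · simp only [← hmin0] at hc
    have := hopen z0 hz0 {z | h z < c} ((isOpen_lt hh continuous_const).mem_nhds hc)
    rw [hLz0] at this
    filter_upwards [this, self_mem_nhdsWithin] with y hy hyZ
    obtain ⟨z, hz, hLz, hmin, hle⟩ := attained Z hZ L hL h hh y hyZ
    obtain ⟨z', hz', hc', hL'⟩ := hy
    rw [← hmin]
    exact lt_of_le_of_lt (hle z' hz' hL') hc'

open Topology Filter in
/-- Lemma A.5, affine case: on a nonempty compact convex polyhedron `𝒵`, for an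
affine `g(z) = z'a + c`, the infimum function `ǧ(w) = inf{g(z) : z ∈ 𝒵, Mz = w}`
is continuous on `𝒲 = M(𝒵)` and admits a continuous selection `ψ` of
minimizers. -/
theorem stmt_15 (mm dd : ℕ) (Zset : Set (Fin mm → ℝ))
    (l : ℕ) (aa : Fin l → Fin mm → ℝ) (bb : Fin l → ℝ)
    -- `𝒵` is a nonempty compact convex polyhedron
    (hZpoly : Zset = {z : Fin mm → ℝ | ∀ i : Fin l, z ⬝ᵥ aa i ≤ bb i})
    (hZbdd : Bornology.IsBounded Zset) (hZne : Zset.Nonempty)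
    (M : (Fin mm → ℝ) →ₗ[ℝ] (Fin dd → ℝ))
    (g : (Fin mm → ℝ) → ℝ)
    -- `g` is affine: `g(z) = z'a + c`
    (a : Fin mm → ℝ) (c : ℝ) (hg : ∀ z : Fin mm → ℝ, g z = z ⬝ᵥ a + c) :
    ContinuousOn (fun w => sInf (g '' {z ∈ Zset | M z = w})) (M '' Zset) ∧
    ∃ ψ : (Fin dd → ℝ) → (Fin mm → ℝ), ContinuousOn ψ (M '' Zset) ∧
      ∀ w ∈ M '' Zset, ψ w ∈ Zset ∧ M (ψ w) = w ∧
        g (ψ w) = sInf (g '' {z ∈ Zset | M z = w}) := by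
  have hdc : ∀ b : Fin mm → ℝ, Continuous fun z : Fin mm → ℝ => z ⬝ᵥ b := fun b => by
    unfold dotProduct; fun_prop
  have hclosed : IsClosed Zset := by
    rw [hZpoly, Set.ofPred_forall]
    exact isClosed_iInter fun i => isClosed_le (hdc _) continuous_const
  have hcomp : IsCompact Zset := Metric.isCompact_of_isClosed_isBounded hclosed hZbdd
  have hconv : Convex ℝ Zset := by
    rw [hZpoly]
    intro x hx y hy s t hs ht hst i
    rw [add_dotProduct, smul_dotProduct, smul_dotProduct, smul_eq_mul, smul_eq_mul]
    have h1 := mul_le_mul_of_nonneg_left (hx i) hs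
    have h2 := mul_le_mul_of_nonneg_left (hy i) ht
    calc _ ≤ s * bb i + t * bb i := add_le_add h1 h2
      _ = bb i := by rw [← add_mul, hst, one_mul]
  have hfin : (Set.extremePoints ℝ Zset).Finite := by
    rw [hZpoly]; exact finite_extreme mm l aa bb
  obtain ⟨S, hS⟩ : ∃ S : Finset (Fin mm → ℝ), Zset = convexHull ℝ (S : Set (Fin mm → ℝ)) := by
    refine ⟨hfin.toFinset, ?_⟩
    have h := closure_convexHull_extremePoints hcomp hconv
    rw [(Set.Finite.isClosed_convexHull ℝ hfin).closure_eq] at h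
    rw [hfin.coe_toFinset, h]
  have hMc : Continuous M := M.continuous_of_finiteDimensional
  have hgc : Continuous g := by
    rw [funext hg]; exact (hdc a).add continuous_const
  have hcont1 : ContinuousOn (fun w => sInf (g '' {z ∈ Zset | M z = w})) (M '' Zset) := by
    refine berge Zset hcomp M hMc g hgc ?_
    intro z0 hz0 U hU
    rw [hS] at hz0 ⊢
    exact open_map M S z0 hz0 U hU
  refine ⟨hcont1, ?_⟩
  let A : (Fin mm → ℝ) →ₗ[ℝ] ℝ :=
    { toFun := fun z => z ⬝ᵥ a
      map_add' := fun x y => add_dotProduct x y a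
      map_smul' := fun r x => smul_dotProduct r x a }
  let L : (Fin mm → ℝ) →ₗ[ℝ] (Fin dd → ℝ) × ℝ := M.prod A
  have hLc : Continuous L := L.continuous_of_finiteDimensional
  let N : (Fin mm → ℝ) → ℝ := fun z => z ⬝ᵥ z
  have hNc : Continuous N := by
    change Continuous fun z : Fin mm → ℝ => z ⬝ᵥ z
    unfold dotProduct; fun_prop
  have hcont2 : ContinuousOn (fun w => sInf (N '' {z ∈ Zset | L z = w})) (L '' Zset) := by
    refine berge Zset hcomp L hLc N hNc ?_
    intro z0 hz0 U hU
    rw [hS] at hz0 ⊢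
    exact open_map L S z0 hz0 U hU
  set γ : (Fin dd → ℝ) → ℝ := fun w => sInf (g '' {z ∈ Zset | M z = w}) with hγ
  let q : (Fin dd → ℝ) → ℝ := fun w => sInf (N '' {z ∈ Zset | L z = (w, γ w - c)})
  have hLiff : ∀ z w, L z = (w, γ w - c) ↔ M z = w ∧ g z = γ w := by
    intro z w
    rw [hg z]
    change (M z, z ⬝ᵥ a) = (w, γ w - c) ↔ _
    rw [Prod.mk.injEq, eq_sub_iff_add_eq]
  have hmem : ∀ w ∈ M '' Zset, ((w, γ w - c) : (Fin dd → ℝ) × ℝ) ∈ L '' Zset := by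
    intro w hw
    obtain ⟨z, hz, hMz, hgz, -⟩ := attained Zset hcomp M hMc g hgc w hw
    exact ⟨z, hz, (hLiff z w).2 ⟨hMz, hgz⟩⟩
  have hq : ContinuousOn q (M '' Zset) :=
    ContinuousOn.comp (f := fun w => ((w, γ w - c) : (Fin dd → ℝ) × ℝ)) hcont2
      (continuousOn_id.prodMk (hcont1.sub continuousOn_const)) hmem
  have hex : ∀ w, ∃ z, w ∈ M '' Zset → z ∈ Zset ∧ M z = w ∧ g z = γ w ∧ N z = q w := by
    intro w
    by_cases hw : w ∈ M '' Zset
    · obtain ⟨z, hz, hLz, hNz, -⟩ := attained Zset hcomp L hLc N hNc _ (hmem w hw)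
      obtain ⟨h1, h2⟩ := (hLiff z w).1 hLz
      exact ⟨z, fun _ => ⟨hz, h1, h2, hNz⟩⟩
    · exact ⟨0, fun h => absurd h hw⟩
  choose ψ hψ using hex
  have huniq : ∀ w ∈ M '' Zset, ∀ z z', z ∈ Zset → M z = w → g z = γ w → N z = q w →
      z' ∈ Zset → M z' = w → g z' = γ w → N z' = q w → z = z' := by
    intro w hw z z' hz hM hgz hN hz' hM' hgz' hN'
    obtain ⟨z1, hz1, hLz1, hNz1, hle⟩ := attained Zset hcomp L hLc N hNc _ (hmem w hw)
    have hm : (1/2 : ℝ) • z + (1/2 : ℝ) • z' ∈ Zset :=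
      hconv hz hz' (by norm_num) (by norm_num) (by norm_num)
    have hLm : L ((1/2 : ℝ) • z + (1/2 : ℝ) • z') = (w, γ w - c) := by
      rw [map_add, map_smul, map_smul, (hLiff z w).2 ⟨hM, hgz⟩, (hLiff z' w).2 ⟨hM', hgz'⟩,
        ← add_smul]
      norm_num
    have h1 := hle _ hm hLm
    have h2 : q w = N z1 := hNz1.symm
    have h3 : N ((1/2 : ℝ) • z + (1/2 : ℝ) • z') =
        1/2 * N z + 1/2 * N z' - 1/4 * ((z - z') ⬝ᵥ (z - z')) := by
      simp only [N, add_dotProduct, dotProduct_add, smul_dotProduct, dotProduct_smul,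
        sub_dotProduct, dotProduct_sub, smul_eq_mul, dotProduct_comm z' z]
      ring
    have h4 : 0 ≤ (z - z') ⬝ᵥ (z - z') := Finset.sum_nonneg fun i _ => mul_self_nonneg _
    have h5 : (z - z') ⬝ᵥ (z - z') = 0 := by linarith
    exact sub_eq_zero.1 (dotProduct_self_eq_zero.1 h5)
  refine ⟨ψ, ?_, fun w hw => ⟨(hψ w hw).1, (hψ w hw).2.1, (hψ w hw).2.2.1⟩⟩
  have hmaps : Set.MapsTo M Zset (M '' Zset) := Set.mapsTo_image _ _
  have hf1 : ContinuousOn (fun z => g z - γ (M z)) Zset :=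
    hgc.continuousOn.sub (hcont1.comp hMc.continuousOn hmaps)
  have hf2 : ContinuousOn (fun z => N z - q (M z)) Zset :=
    hNc.continuousOn.sub (hq.comp hMc.continuousOn hmaps)
  have hK : IsClosed ((Zset ∩ (fun z => g z - γ (M z)) ⁻¹' {0}) ∩
      (Zset ∩ (fun z => N z - q (M z)) ⁻¹' {0})) :=
    (hf1.preimage_isClosed_of_isClosed hclosed isClosed_singleton).inter
      (hf2.preimage_isClosed_of_isClosed hclosed isClosed_singleton)
  set K := ((Zset ∩ (fun z => g z - γ (M z)) ⁻¹' {0}) ∩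
      (Zset ∩ (fun z => N z - q (M z)) ⁻¹' {0})) with hKdef
  have hKc : IsCompact K := hcomp.of_isClosed_subset hK fun z hz => hz.1.1
  intro w hw
  rw [ContinuousWithinAt, tendsto_nhds]
  intro U hUo hwU
  have hcl : IsClosed (M '' (K ∩ Uᶜ)) :=
    ((hKc.inter_right hUo.isClosed_compl).image hMc).isClosed
  have hn : w ∉ M '' (K ∩ Uᶜ) := by
    rintro ⟨z, ⟨⟨⟨hz, h1⟩, ⟨-, h2⟩⟩, hzU⟩, rfl⟩
    obtain ⟨p1, p2, p3, p4⟩ := hψ _ hw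
    have : z = ψ (M z) := huniq _ hw _ _ hz rfl (sub_eq_zero.1 h1) (sub_eq_zero.1 h2) p1 p2 p3 p4
    exact hzU (this ▸ hwU)
  filter_upwards [mem_nhdsWithin_of_mem_nhds (hcl.isOpen_compl.mem_nhds hn),
    self_mem_nhdsWithin] with y hy hyZ
  by_contra hcon
  obtain ⟨p1, p2, p3, p4⟩ := hψ _ hyZ
  refine hy ⟨ψ y, ⟨⟨⟨p1, ?_⟩, ⟨p1, ?_⟩⟩, hcon⟩, p2⟩
  · simp [p2, p3]
  · simp [p2, p4]
end

section
/- There exists a continuous quasiconvex function g : ℝ² → ℝ such that, taking 𝒵 = [−2,2] × [−2,2] and defining ǧ(w) = inf{g(z) : z ∈ 𝒵, z₁ = w} for w ∈ [−2,2], there is no continuous function ψ : [−2,2] → 𝒵 satisfying ψ₁(w) = w and g(ψ(w)) = ǧ(w) for all w ∈ [−2,2]. In other words, continuity of g together with quasiconvexity (without strictness) does not suffice for the existence of a continuous selection of minimizers. (Example A.1) -/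
open Matrix

/-- The function of the example; on the box it equals `-z₁ / (z₂ + 3)`. -/
noncomputable def gEx (z : Fin 2 → ℝ) : ℝ :=
  min 2 (max (-z 0 / max (z 1 + 3) (1/2)) (-8 * z 1 - 18))

lemma gEx_continuous : Continuous gEx := by
  unfold gEx
  refine continuous_const.min (Continuous.max (Continuous.div (by fun_prop) (by fun_prop) ?_)
    (by fun_prop))
  intro z
  have : (1/2 : ℝ) ≤ max (z 1 + 3) (1/2) := le_max_right _ _
  linarith

lemma gEx_le_iff (z : Fin 2 → ℝ) (r : ℝ) (hr : r < 2) :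
    gEx z ≤ r ↔ -z 0 ≤ r * (z 1 + 3) ∧ -8 * z 1 - 18 ≤ r := by
  unfold gEx
  rw [min_le_iff, max_le_iff]
  have h2 : ¬ (2 : ℝ) ≤ r := not_le.mpr hr
  simp only [h2, false_or]
  refine and_congr_left fun h => ?_
  have h3 : (1/2 : ℝ) ≤ z 1 + 3 := by linarith
  rw [max_eq_left h3, div_le_iff₀ (by linarith)]

lemma gEx_convex (r : ℝ) : Convex ℝ {z : Fin 2 → ℝ | gEx z ≤ r} := by
  rcases lt_or_ge r 2 with hr | hr
  · intro x hx y hy a b ha hb hab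
    simp only [Set.mem_setOf_eq, gEx_le_iff _ _ hr] at *
    simp only [Pi.add_apply, Pi.smul_apply, smul_eq_mul]
    obtain rfl : b = 1 - a := by linarith
    constructor
    · nlinarith [mul_le_mul_of_nonneg_left hx.1 ha, mul_le_mul_of_nonneg_left hy.1 hb]
    · nlinarith [mul_le_mul_of_nonneg_left hx.2 ha, mul_le_mul_of_nonneg_left hy.2 hb]
  · have : {z : Fin 2 → ℝ | gEx z ≤ r} = Set.univ :=
      Set.eq_univ_of_forall fun z => (min_le_left _ _).trans hr
    rw [this]
    exact convex_univ

lemma gEx_box (z : Fin 2 → ℝ)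
    (hz : z ∈ Set.Icc (fun _ : Fin 2 => (-2 : ℝ)) (fun _ : Fin 2 => (2 : ℝ))) :
    gEx z = -z 0 / (z 1 + 3) ∧ -2 ≤ gEx z := by
  have a0 := hz.1 0
  have a1 := hz.1 1
  have b0 := hz.2 0
  have b1 := hz.2 1
  simp only at a0 a1 b0 b1
  have hp : 0 < z 1 + 3 := by linarith
  have hl : -2 ≤ -z 0 / (z 1 + 3) := by rw [le_div_iff₀ hp]; linarith
  have hu : -z 0 / (z 1 + 3) ≤ 2 := by rw [div_le_iff₀ hp]; linarith
  have : gEx z = -z 0 / (z 1 + 3) := by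
    unfold gEx
    rw [max_eq_left (by linarith : (1/2 : ℝ) ≤ z 1 + 3), max_eq_left (by linarith),
      min_eq_right hu]
  exact ⟨this, this ▸ hl⟩

/-- Example A.1: there is a continuous quasiconvex function `g : ℝ² → ℝ` for
which, with `𝒵 = [-2,2] × [-2,2]` and `ǧ(w) = inf{g(z) : z ∈ 𝒵, z₁ = w}`, no
continuous selection of minimizers `ψ : [-2,2] → 𝒵` with `ψ₁(w) = w` and
`g(ψ(w)) = ǧ(w)` exists. -/
theorem stmt_16 :
    ∃ g : (Fin 2 → ℝ) → ℝ, Continuous g ∧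
      (∀ r : ℝ, Convex ℝ {z : Fin 2 → ℝ | g z ≤ r}) ∧
      ¬ ∃ ψ : ℝ → (Fin 2 → ℝ),
          ContinuousOn ψ (Set.Icc (-2 : ℝ) 2) ∧
          ∀ w ∈ Set.Icc (-2 : ℝ) 2,
            ψ w ∈ Set.Icc (fun _ : Fin 2 => (-2 : ℝ)) (fun _ : Fin 2 => (2 : ℝ)) ∧
            ψ w 0 = w ∧
            g (ψ w) = sInf (g '' {z ∈ Set.Icc (fun _ : Fin 2 => (-2 : ℝ))
              (fun _ : Fin 2 => (2 : ℝ)) | z 0 = w}) := by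
  refine ⟨gEx, gEx_continuous, gEx_convex, ?_⟩
  rintro ⟨ψ, hc, h⟩
  have key : ∀ w ∈ Set.Icc (-2 : ℝ) 2, ∀ y ∈ Set.Icc (-2 : ℝ) 2,
      -w / (ψ w 1 + 3) ≤ -w / (y + 3) := by
    intro w hw y hy
    obtain ⟨hb, h0, he⟩ := h w hw
    have hm : (![w, y] : Fin 2 → ℝ) ∈
        Set.Icc (fun _ : Fin 2 => (-2 : ℝ)) (fun _ : Fin 2 => (2 : ℝ)) := by
      constructor <;> intro i <;> fin_cases i <;> simp [hw.1, hw.2, hy.1, hy.2]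
    have h1 : gEx (ψ w) ≤ gEx ![w, y] := by
      rw [he]
      refine csInf_le ⟨-2, ?_⟩ ⟨![w, y], ⟨hm, by simp⟩, rfl⟩
      rintro _ ⟨z, hz, rfl⟩
      exact (gEx_box z hz.1).2
    rw [(gEx_box _ hb).1, (gEx_box _ hm).1, h0] at h1
    simpa using h1
  have hlow : ∀ w ∈ Set.Icc (-2 : ℝ) 2, -2 ≤ ψ w 1 := fun w hw => (h w hw).1.1 1
  have hpos : ∀ w ∈ Set.Icc (-2 : ℝ) 2, 0 < w → ψ w 1 ≤ -2 := by
    intro w hw hw0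
    have k := key w hw (-2) (by norm_num)
    have hl := hlow w hw
    rw [div_le_div_iff₀ (by linarith) (by norm_num)] at k
    nlinarith
  have hneg : ∀ w ∈ Set.Icc (-2 : ℝ) 2, w < 0 → 2 ≤ ψ w 1 := by
    intro w hw hw0
    have k := key w hw 2 (by norm_num)
    have hl := hlow w hw
    rw [div_le_div_iff₀ (by linarith) (by norm_num)] at k
    nlinarith
  have hc1 : ContinuousOn (fun w => ψ w 1) (Set.Icc (-2 : ℝ) 2) :=
    (continuous_apply (1 : Fin 2)).comp_continuousOn hc
  have ivt := intermediate_value_Icc' (by norm_num : (-2 : ℝ) ≤ 2) hc1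
  have hL := hneg (-2) (by norm_num) (by norm_num)
  have hR := hpos 2 (by norm_num) (by norm_num)
  have hz : ∀ y : ℝ, -2 < y → y < 2 → ψ 0 1 = y := by
    intro y hy1 hy2
    obtain ⟨w, hw, hwy⟩ := ivt (⟨by linarith, by linarith⟩ : y ∈ Set.Icc (ψ 2 1) (ψ (-2) 1))
    simp only at hwy
    rcases lt_trichotomy w 0 with h1 | h1 | h1
    · linarith [hneg w hw h1]
    · rw [← h1]; exact hwy
    · linarith [hpos w hw h1]
  linarith [hz 0 (by norm_num) (by norm_num), hz 1 (by norm_num) (by norm_num)]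
end
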